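/- arXiv:1805.06929 — 2 statements merged into one kernel-verified Lean document; each statement's English description precedes it below -/
import Mathlib

section
/- Let α, ν, β > 0, κ ∈ (0,1) with κ(α/ν − 1) < 1, and let f be the κGG density. Define the Pareto exponent a = (ν/κ)·[1 − κ(α/ν − 1)] and the characteristic scale x₀ = β·[ (1 + κ(α/ν − 1)) · Γ_κ(α/ν)^{−1} · (2κ)^{−1/κ} ]^{κ/(ν[1 − κ(α/ν − 1)])}. Then lim_{x→∞} x^{a+1} · f(x) = a·x₀^a; i.e. the κGG distribution has a power-law (Pareto) upper tail f(x) ∼ a x₀^a / x^{a+1}. -/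
open Real MeasureTheory Filter Set

/-- The κ-deformed exponential of Kaniadakis. -/
noncomputable def kexp (κ x : ℝ) : ℝ := (Real.sqrt (1 + κ^2 * x^2) + κ * x) ^ (1/κ)

/-- The κ-deformed logarithm of Kaniadakis. -/
noncomputable def klog (κ x : ℝ) : ℝ := (x ^ κ - x ^ (-κ)) / (2*κ)

/-- The κ-deformed Gamma function (closed form in terms of the Euler Gamma function). -/
noncomputable def kGamma (κ z : ℝ) : ℝ :=
  ((1 - κ*(z-1)) / (2*κ) ^ (z-1)) *
    (Real.Gamma (1/(2*κ) - (z-1)/2) / Real.Gamma (1/(2*κ) + (z-1)/2)) * Real.Gamma z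

/-- The κ-Generalized Gamma (κGG) density. -/
noncomputable def kGG (α ν β κ x : ℝ) : ℝ :=
  (1 - κ^2*(α/ν - 1)^2) * (ν/β) * (kGamma κ (α/ν))⁻¹ * (x/β) ^ (α-1) *
    kexp κ (-((x/β) ^ ν)) / Real.sqrt (1 + κ^2 * (x/β) ^ (2*ν))

theorem kGamma_pos {κ z : ℝ} (hκ : 0 < κ) (hz : 0 < z) (h : κ * (z - 1) < 1)
    (h' : -1 < κ * (z - 1)) : 0 < kGamma κ z := by
  have h₁ : 0 < 1/(2*κ) - (z-1)/2 := by
    have : 1/(2*κ) - (z-1)/2 = (1 - κ * (z-1)) / (2*κ) := by field_simp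
    rw [this]; exact div_pos (by linarith) (by linarith)
  have h₂ : 0 < 1/(2*κ) + (z-1)/2 := by
    have : 1/(2*κ) + (z-1)/2 = (1 + κ * (z-1)) / (2*κ) := by field_simp
    rw [this]; exact div_pos (by linarith) (by linarith)
  have h₃ : 0 < 1 - κ*(z-1) := by linarith
  have := Real.Gamma_pos_of_pos h₁
  have := Real.Gamma_pos_of_pos h₂
  have := Real.Gamma_pos_of_pos hz
  unfold kGamma
  positivity

theorem sqrt_one_add_sq_mul_sq {κ y : ℝ} (hy : 0 < y) :
    √(1 + κ^2 * y^2) = y * √((y⁻¹)^2 + κ^2) := by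
  have : 1 + κ^2 * y^2 = y^2 * ((y⁻¹)^2 + κ^2) := by field_simp
  rw [this, Real.sqrt_mul (sq_nonneg y), Real.sqrt_sq hy.le]

theorem kexp_neg {κ x : ℝ} (hκ : 0 < κ) (hx : 0 < x) :
    kexp κ (-x) = (√(1 + κ^2 * x^2) + κ * x) ^ (-(1/κ)) := by
  have hpos : 0 < √(1 + κ^2 * x^2) + κ * x := by positivity
  have hinv : √(1 + κ^2 * (-x)^2) + κ * (-x) = (√(1 + κ^2 * x^2) + κ * x)⁻¹ := by
    rw [neg_sq]
    refine eq_inv_of_mul_eq_one_left ?_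
    have := Real.sq_sqrt (show 0 ≤ 1 + κ^2 * x^2 by positivity)
    linear_combination this
  rw [kexp, hinv, Real.inv_rpow hpos.le, Real.rpow_neg hpos.le]

theorem rpow_mul_kexp_neg_div_sqrt {κ y : ℝ} (hκ : 0 < κ) (hy : 0 < y) :
    y ^ (1/κ) * y * (kexp κ (-y) / √(1 + κ^2 * y^2)) =
      (√((y⁻¹)^2 + κ^2) + κ) ^ (-(1/κ)) / √((y⁻¹)^2 + κ^2) := by
  have hr : 0 < √((y⁻¹)^2 + κ^2) := by positivity
  rw [kexp_neg hκ hy, sqrt_one_add_sq_mul_sq hy]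
  set r := √((y⁻¹)^2 + κ^2)
  rw [show y * r + κ * y = y * (r + κ) by ring, Real.mul_rpow hy.le (by positivity),
    Real.rpow_neg hy.le]
  have : 0 < y ^ (1/κ) := by positivity
  field_simp

theorem tendsto_rpow_mul_kexp_neg_div_sqrt {κ : ℝ} (hκ : 0 < κ) :
    Tendsto (fun y : ℝ => y ^ (1/κ) * y * (kexp κ (-y) / √(1 + κ^2 * y^2))) atTop
      (nhds ((2*κ) ^ (-(1/κ)) / κ)) := by
  have hr : Tendsto (fun y : ℝ => √((y⁻¹)^2 + κ^2)) atTop (nhds κ) := by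
    have := (((tendsto_inv_atTop_zero (𝕜 := ℝ)).pow 2).add_const (κ^2)).sqrt
    simpa [Real.sqrt_sq hκ.le] using this
  have hlim := ((hr.add_const κ).rpow_const (p := -(1/κ)) (Or.inl (by positivity))).div hr hκ.ne'
  rw [← two_mul] at hlim
  refine hlim.congr' ?_
  filter_upwards [eventually_gt_atTop 0] with y hy
  exact (rpow_mul_kexp_neg_div_sqrt hκ hy).symm

theorem rpow_mul_kGG {α ν β κ a x : ℝ} (hβ : 0 < β) (hx : 0 < x)
    (hexp : a + α = ν * (1/κ) + ν) :
    x ^ (a+1) * kGG α ν β κ x =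
      ((1 - κ^2*(α/ν - 1)^2) * ν * (kGamma κ (α/ν))⁻¹ * β ^ a) *
        (((x/β) ^ ν) ^ (1/κ) * (x/β) ^ ν *
          (kexp κ (-((x/β) ^ ν)) / √(1 + κ^2 * ((x/β) ^ ν)^2))) := by
  have hw : 0 < x/β := by positivity
  have hsq : (x/β) ^ (2*ν) = ((x/β) ^ ν)^2 := by
    rw [mul_comm, Real.rpow_mul hw.le, Real.rpow_two]
  have hxa : x ^ (a+1) = β ^ a * β * (x/β) ^ (a+1) := by
    rw [← Real.rpow_add_one hβ.ne', ← Real.mul_rpow hβ.le hw.le, mul_div_cancel₀ _ hβ.ne']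
  have hpow : (x/β) ^ (a+1) * (x/β) ^ (α-1) = ((x/β) ^ ν) ^ (1/κ) * (x/β) ^ ν := by
    rw [← Real.rpow_mul hw.le, ← Real.rpow_add hw, ← Real.rpow_add hw, ← hexp]
    congr 1; ring
  rw [← hpow, hxa, kGG, hsq]
  field_simp

/-- Pareto power-law upper tail of the κGG density: `f(x) ∼ a x₀^a / x^(a+1)` as `x → ∞`. -/
theorem kGG_pareto_tail (α ν β κ : ℝ) (hα : 0 < α) (hν : 0 < ν) (hβ : 0 < β)
    (hκ : κ ∈ Set.Ioo (0:ℝ) 1) (h : κ * (α/ν - 1) < 1)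
    (a x₀ : ℝ)
    (ha : a = (ν/κ) * (1 - κ*(α/ν - 1)))
    (hx₀ : x₀ = β * ((1 + κ*(α/ν - 1)) * (kGamma κ (α/ν))⁻¹ * (2*κ) ^ (-(1/κ)))
            ^ (κ / (ν * (1 - κ*(α/ν - 1))))) :
    Filter.Tendsto (fun x : ℝ => x ^ (a+1) * kGG α ν β κ x) Filter.atTop
      (nhds (a * x₀ ^ a)) := by
  obtain ⟨hκ, hκ₁⟩ := hκ
  have hz : 0 < α/ν := div_pos hα hν
  have hu : -1 < κ * (α/ν - 1) := by nlinarith [mul_pos hκ hz]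
  have ht : 0 < 1 - κ * (α/ν - 1) := by linarith
  have hu' : 0 < 1 + κ * (α/ν - 1) := by linarith
  have hG := kGamma_pos hκ hz h hu
  have hexp : a + α = ν * (1/κ) + ν := by rw [ha]; field_simp; ring
  have hx₀a : x₀ ^ a =
      β ^ a * ((1 + κ*(α/ν - 1)) * (kGamma κ (α/ν))⁻¹ * (2*κ) ^ (-(1/κ))) := by
    have hone : κ / (ν * (1 - κ*(α/ν - 1))) * a = 1 := by
      rw [ha]
      generalize 1 - κ*(α/ν - 1) = t at ht
      field_simp
    rw [hx₀, Real.mul_rpow hβ.le (by positivity), ← Real.rpow_mul (by positivity), hone,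
      Real.rpow_one]
  have hy : Tendsto (fun x : ℝ => (x/β) ^ ν) atTop atTop :=
    (tendsto_rpow_atTop hν).comp (tendsto_id.atTop_div_const hβ)
  have hlim := ((tendsto_rpow_mul_kexp_neg_div_sqrt hκ).comp hy).const_mul
    ((1 - κ^2*(α/ν - 1)^2) * ν * (kGamma κ (α/ν))⁻¹ * β ^ a)
  have hval : a * x₀ ^ a = (1 - κ^2*(α/ν - 1)^2) * ν * (kGamma κ (α/ν))⁻¹ * β ^ a *
      ((2*κ) ^ (-(1/κ)) / κ) := by
    rw [hx₀a]
    nth_rewrite 1 [ha]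
    ring
  rw [hval]
  refine hlim.congr' ?_
  filter_upwards [eventually_gt_atTop 0] with x hx
  exact (rpow_mul_kGG hβ hx hexp).symm
end

section
/- Let α, ν, β > 0, κ ∈ (0,1) with κ(α/ν − 1) < 1, and let f be the κGG density. For every real r with −α < r < ν/κ + (ν − α), the r-th moment about the origin exists and equals μ'_r = ∫₀^∞ x^r f(x) dx = β^r · (2κ)^{−r/ν} · [1 + κ(α/ν − 1)]/[1 + κ((α+r)/ν − 1)] · Γ(1/(2κ) − (α−ν+r)/(2ν))/Γ(1/(2κ) + (α−ν+r)/(2ν)) · Γ(1/(2κ) + (α−ν)/(2ν))/Γ(1/(2κ) − (α−ν)/(2ν)) · Γ((α+r)/ν)/Γ(α/ν). -/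
open Real MeasureTheory Filter Set

theorem integrableOn_Ioo_and_integral_beta {u v : ℝ} (hu : 0 < u) (hv : 0 < v) :
    IntegrableOn (fun x : ℝ => x ^ (u - 1) * (1 - x) ^ (v - 1)) (Ioo 0 1) ∧
    ∫ x in Ioo (0 : ℝ) 1, x ^ (u - 1) * (1 - x) ^ (v - 1) =
      Real.Gamma u * Real.Gamma v / Real.Gamma (u + v) := by
  have hcast : EqOn (fun x : ℝ => (x : ℂ) ^ ((u : ℂ) - 1) * (1 - (x : ℂ)) ^ ((v : ℂ) - 1))
      (fun x : ℝ => ((x ^ (u - 1) * (1 - x) ^ (v - 1) : ℝ) : ℂ)) (Ioo 0 1) := by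
    intro x hx
    have hx1 : 0 ≤ 1 - x := by linarith [hx.2]
    simp only [Complex.ofReal_mul, Complex.ofReal_cpow hx.1.le, Complex.ofReal_cpow hx1]
    push_cast
    rfl
  constructor
  · have hint := Complex.betaIntegral_convergent (u := u) (v := v) (by simpa) (by simpa)
    rw [intervalIntegrable_iff_integrableOn_Ioo_of_le zero_le_one] at hint
    simpa [IntegrableOn] using (hint.congr_fun hcast measurableSet_Ioo).re
  · have hbeta := Complex.betaIntegral_eq_Gamma_mul_div u v (by simpa) (by simpa)
    rw [Complex.betaIntegral, intervalIntegral.integral_of_le zero_le_one,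
      integral_Ioc_eq_integral_Ioo, setIntegral_congr_fun measurableSet_Ioo hcast,
      integral_complex_ofReal, ← Complex.ofReal_add, Complex.Gamma_ofReal, Complex.Gamma_ofReal,
      Complex.Gamma_ofReal] at hbeta
    exact_mod_cast hbeta

/-- The change of variables `t = (w ^ (-1/2) - w ^ (1/2)) / (2κ)` that turns the Mellin transform
of the κ-exponential into a Beta integral. -/
noncomputable def kSubst (κ w : ℝ) : ℝ := (1 - w) / (2 * κ * √w)

theorem sqrt_one_add_sq_kSubst {κ w : ℝ} (hκ : 0 < κ) (hw : 0 < w) :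
    √(1 + κ ^ 2 * kSubst κ w ^ 2) = (1 + w) / (2 * √w) := by
  have hv : 0 < √w := sqrt_pos.2 hw
  rw [sqrt_eq_iff_mul_self_eq (by positivity) (by positivity), kSubst]
  field_simp
  rw [sq_sqrt hw.le]
  ring

theorem sqrt_sub_mul_kSubst {κ w : ℝ} (hκ : 0 < κ) (hw : 0 < w) :
    √(1 + κ ^ 2 * kSubst κ w ^ 2) - κ * kSubst κ w = √w := by
  have hv : 0 < √w := sqrt_pos.2 hw
  rw [sqrt_one_add_sq_kSubst hκ hw, kSubst]
  field_simp
  rw [sq_sqrt hw.le]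
  ring

theorem kexp_neg_kSubst {κ w : ℝ} (hκ : 0 < κ) (hw : 0 < w) :
    kexp κ (-kSubst κ w) = w ^ (1 / (2 * κ)) := by
  rw [kexp, neg_sq, mul_neg, ← sub_eq_add_neg, sqrt_sub_mul_kSubst hκ hw, sqrt_eq_rpow,
    ← rpow_mul hw.le]
  congr 1
  field_simp

theorem injOn_kSubst {κ : ℝ} (hκ : 0 < κ) : InjOn (kSubst κ) (Ioo 0 1) := by
  intro x hx y hy hxy
  have hsqrt : √x = √y := by
    rw [← sqrt_sub_mul_kSubst hκ hx.1, ← sqrt_sub_mul_kSubst hκ hy.1, hxy]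
  exact (sqrt_inj hx.1.le hy.1.le).1 hsqrt

theorem image_kSubst_Ioo {κ : ℝ} (hκ : 0 < κ) : kSubst κ '' Ioo 0 1 = Ioi 0 := by
  ext t
  constructor
  · rintro ⟨w, hw, rfl⟩
    have hv : 0 < √w := sqrt_pos.2 hw.1
    have hw1 : 0 < 1 - w := by linarith [hw.2]
    exact div_pos hw1 (by positivity)
  · intro ht
    have hκt : 0 < κ * t := mul_pos hκ ht
    set q := √(1 + κ ^ 2 * t ^ 2) with hq
    have hq2 : q ^ 2 = 1 + κ ^ 2 * t ^ 2 := sq_sqrt (by positivity)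
    have hq0 : 0 ≤ q := sqrt_nonneg _
    have hlt : κ * t < q := by nlinarith
    have hlt1 : q < 1 + κ * t := by nlinarith
    refine ⟨(q - κ * t) ^ 2, ⟨pow_pos (by linarith) 2, by nlinarith⟩, ?_⟩
    rw [kSubst, sqrt_sq (by linarith), div_eq_iff (by nlinarith)]
    linear_combination -hq2

theorem hasDerivAt_kSubst {κ w : ℝ} (hκ : 0 < κ) (hw : 0 < w) :
    HasDerivAt (kSubst κ) (-((1 + w) / (4 * κ * w * √w))) w := by
  have hv : 0 < √w := sqrt_pos.2 hw
  have hderiv := ((hasDerivAt_id w).const_sub 1).div ((hasDerivAt_sqrt hw.ne').const_mul (2 * κ))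
    (by positivity)
  refine hderiv.congr_deriv ?_
  simp only [id]
  have hv2 : √w ^ 2 = w := sq_sqrt hw.le
  generalize √w = v at *
  subst hv2
  field_simp
  ring

theorem kSubst_jacobian {κ s w : ℝ} (hκ : 0 < κ) (hw : w ∈ Ioo (0 : ℝ) 1) :
    |-((1 + w) / (4 * κ * w * √w))| • (kSubst κ w ^ (s - 1) * kexp κ (-kSubst κ w) /
      √(1 + κ ^ 2 * kSubst κ w ^ 2)) =
    (2 * κ) ^ (-s) * (w ^ (1 / (2 * κ) - (s - 1) / 2 - 1) * (1 - w) ^ (s - 1)) := by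
  have hw0 := hw.1
  have hw1 : 0 < 1 - w := by linarith [hw.2]
  have hv : 0 < √w := sqrt_pos.2 hw0
  rw [kexp_neg_kSubst hκ hw0, sqrt_one_add_sq_kSubst hκ hw0, abs_neg, abs_of_pos (by positivity),
    kSubst, div_rpow hw1.le (by positivity), mul_rpow (by positivity) hv.le, rpow_sub_one hw0.ne',
    rpow_sub hw0, rpow_neg (by positivity), rpow_sub_one (x := 2 * κ) (by positivity),
    show w ^ ((s - 1) / 2) = √w ^ (s - 1) by
      rw [sqrt_eq_rpow, ← rpow_mul hw0.le]; congr 1; ring, smul_eq_mul]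
  field_simp
  ring

theorem integrableOn_and_integral_kexp_mellin {κ s : ℝ} (hκ : κ ∈ Ioo (0 : ℝ) 1) (hs : 0 < s)
    (hs' : κ * (s - 1) < 1) :
    IntegrableOn (fun t : ℝ => t ^ (s - 1) * kexp κ (-t) / √(1 + κ ^ 2 * t ^ 2)) (Ioi 0) ∧
    ∫ t in Ioi (0 : ℝ), t ^ (s - 1) * kexp κ (-t) / √(1 + κ ^ 2 * t ^ 2) =
      (2 * κ) ^ (1 - s) * Real.Gamma s * Real.Gamma (1 / (2 * κ) - (s - 1) / 2) /
        Real.Gamma (1 / (2 * κ) + (s - 1) / 2) / (1 + κ * (s - 1)) := by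
  obtain ⟨hκ0, hκ1⟩ := hκ
  have hu : 0 < 1 / (2 * κ) - (s - 1) / 2 := by
    rw [show 1 / (2 * κ) - (s - 1) / 2 = (1 - κ * (s - 1)) / (2 * κ) by field_simp]
    exact div_pos (by linarith) (by positivity)
  have hpos : 0 < 1 + κ * (s - 1) := by nlinarith
  have hv : 1 / (2 * κ) + (s - 1) / 2 = (1 + κ * (s - 1)) / (2 * κ) := by field_simp
  have hv0 : 0 < 1 / (2 * κ) + (s - 1) / 2 := hv ▸ div_pos hpos (by positivity)
  have hderiv : ∀ w ∈ Ioo (0 : ℝ) 1,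
      HasDerivWithinAt (kSubst κ) (-((1 + w) / (4 * κ * w * √w))) (Ioo 0 1) w :=
    fun w hw => (hasDerivAt_kSubst hκ0 hw.1).hasDerivWithinAt
  have hcongr := fun w (hw : w ∈ Ioo (0 : ℝ) 1) => kSubst_jacobian (s := s) hκ0 hw
  obtain ⟨hint, hbeta⟩ := integrableOn_Ioo_and_integral_beta hu hs
  rw [← image_kSubst_Ioo hκ0]
  constructor
  · rw [integrableOn_image_iff_integrableOn_abs_deriv_smul measurableSet_Ioo hderiv
      (injOn_kSubst hκ0), integrableOn_congr_fun hcongr measurableSet_Ioo]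
    exact hint.const_mul _
  · rw [integral_image_eq_integral_abs_deriv_smul measurableSet_Ioo hderiv
      (injOn_kSubst hκ0), setIntegral_congr_fun measurableSet_Ioo hcongr, integral_const_mul,
      hbeta, show 1 / (2 * κ) - (s - 1) / 2 + s = 1 / (2 * κ) + (s - 1) / 2 + 1 by ring,
      Real.Gamma_add_one hv0.ne', sub_eq_add_neg 1 s, rpow_add (by positivity), rpow_one]
    have hΓ := (Real.Gamma_pos_of_pos hv0).ne'
    generalize Real.Gamma (1 / (2 * κ) + (s - 1) / 2) = G at *
    rw [hv]
    field_simp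


/-- Moments about the origin of the κGG distribution. -/
theorem kGG_moments (α ν β κ r : ℝ) (hα : 0 < α) (hν : 0 < ν) (hβ : 0 < β)
    (hκ : κ ∈ Set.Ioo (0:ℝ) 1) (h : κ * (α/ν - 1) < 1)
    (hr1 : -α < r) (hr2 : r < ν/κ + (ν - α)) :
    MeasureTheory.IntegrableOn (fun x : ℝ => x ^ r * kGG α ν β κ x) (Set.Ioi 0) ∧
    ∫ x in Set.Ioi (0:ℝ), x ^ r * kGG α ν β κ x =
      β ^ r * (2*κ) ^ (-(r/ν)) *
      ((1 + κ*(α/ν - 1)) / (1 + κ*((α+r)/ν - 1))) *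
      (Real.Gamma (1/(2*κ) - (α-ν+r)/(2*ν)) / Real.Gamma (1/(2*κ) + (α-ν+r)/(2*ν))) *
      (Real.Gamma (1/(2*κ) + (α-ν)/(2*ν)) / Real.Gamma (1/(2*κ) - (α-ν)/(2*ν))) *
      (Real.Gamma ((α+r)/ν) / Real.Gamma (α/ν)) := by
  obtain ⟨hκ0, hκ1⟩ := hκ
  have hs : 0 < (α + r) / ν := div_pos (by linarith) hν
  have hs' : κ * ((α + r) / ν - 1) < 1 := by
    have hlt : (α + r) / ν < 1 / κ + 1 := by
      rw [div_lt_iff₀ hν, add_mul, one_mul, div_mul_eq_mul_div, one_mul]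
      linarith
    calc κ * ((α + r) / ν - 1) < κ * (1 / κ) := by gcongr; linarith
      _ = 1 := by field_simp
  obtain ⟨hint, hval⟩ := integrableOn_and_integral_kexp_mellin ⟨hκ0, hκ1⟩ hs hs'
  set M : ℝ → ℝ := fun t => t ^ ((α + r) / ν - 1) * kexp κ (-t) / √(1 + κ ^ 2 * t ^ 2) with hM
  set C : ℝ := (1 - κ^2*(α/ν - 1)^2) * (kGamma κ (α/ν))⁻¹ with hC
  have hfun : EqOn (fun x : ℝ => x ^ r * kGG α ν β κ x)
      (fun x => (β ^ r * C * β⁻¹) * (fun y => (ν * y ^ (ν - 1)) • M (y ^ ν)) (β⁻¹ * x))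
      (Ioi 0) := by
    intro x hx
    obtain ⟨y, rfl⟩ : ∃ y, x = β * y := ⟨β⁻¹ * x, by field_simp⟩
    have hy : 0 < y := (mul_pos_iff_of_pos_left hβ).1 hx
    have hpow : y ^ r * y ^ (α - 1) = y ^ (ν - 1) * (y ^ ν) ^ ((α + r) / ν - 1) := by
      rw [← rpow_mul hy.le, ← rpow_add hy, ← rpow_add hy]
      congr 1
      field_simp
      ring
    simp only [hM, hC, kGG, smul_eq_mul, mul_div_cancel_left₀ _ hβ.ne',
      inv_mul_cancel_left₀ hβ.ne', mul_rpow hβ.le hy.le]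
    rw [show y ^ (2 * ν) = (y ^ ν) ^ 2 by rw [← rpow_mul_natCast hy.le]; congr 1; push_cast; ring]
    linear_combination (β ^ r * ((1 - κ^2*(α/ν - 1)^2) * (ν/β) * (kGamma κ (α/ν))⁻¹) *
      kexp κ (-(y ^ ν)) / √(1 + κ ^ 2 * (y ^ ν) ^ 2)) * hpow
  have hsub := (integrableOn_Ioi_comp_rpow_iff M hν.ne').2 hint
  rw [abs_of_pos hν] at hsub
  constructor
  · rw [integrableOn_congr_fun hfun measurableSet_Ioi]
    refine Integrable.const_mul ?_ _
    refine (integrableOn_Ioi_comp_mul_left_iff (fun y => (ν * y ^ (ν - 1)) • M (y ^ ν)) 0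
      (inv_pos.2 hβ)).2 ?_
    rwa [mul_zero]
  · rw [setIntegral_congr_fun measurableSet_Ioi hfun, integral_const_mul,
      integral_comp_mul_left_Ioi (fun y => (ν * y ^ (ν - 1)) • M (y ^ ν)) 0 (inv_pos.2 hβ),
      mul_zero,
      integral_comp_rpow_Ioi_of_pos hν, hval, hC, kGamma]
    rw [show (α - ν + r) / (2 * ν) = ((α + r) / ν - 1) / 2 by field_simp; ring,
      show (α - ν) / (2 * ν) = (α / ν - 1) / 2 by field_simp,
      show -(r / ν) = (1 - (α + r) / ν) + (α / ν - 1) by field_simp; ring,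
      rpow_add (by positivity)]
    have hne : 1 - κ * (α / ν - 1) ≠ 0 := by linarith
    have hne' : (2 * κ) ^ (α / ν - 1) ≠ 0 := by positivity
    generalize (2 * κ) ^ (α / ν - 1) = P at hne' ⊢
    rw [show 1 - κ ^ 2 * (α / ν - 1) ^ 2 = (1 - κ * (α / ν - 1)) * (1 + κ * (α / ν - 1)) by ring]
    rw [smul_eq_mul]
    generalize α / ν = a at hne ⊢
    generalize (α + r) / ν = s
    generalize 1 - κ * (a - 1) = X at hne ⊢
    generalize Real.Gamma (1 / (2 * κ) - (a - 1) / 2) = G₁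
    generalize Real.Gamma (1 / (2 * κ) + (a - 1) / 2) = G₂
    generalize Real.Gamma (1 / (2 * κ) - (s - 1) / 2) = G₃
    generalize Real.Gamma (1 / (2 * κ) + (s - 1) / 2) = G₄
    generalize Real.Gamma a = G₅
    generalize Real.Gamma s = G₆
    generalize 1 + κ * (a - 1) = Y
    generalize 1 + κ * (s - 1) = Z
    generalize (2 * κ) ^ (1 - s) = Q
    field_simp
end
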